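/- Let G be a finite group, H a normal subgroup of prime index p, and F an algebraically closed field of characteristic 0 or coprime to |G|. Let x in G be such that G/H is generated by the image of x. Let η be an irreducible F-representation of H whose primitive central idempotent e_η in F[H] is NOT central in F[G]. Then the induced representations η↑_H^G, η^x↑_H^G, …, η^{x^{p-1}}↑_H^G are all equivalent to a single irreducible representation ρ of G, and the primitive central idempotent of ρ in F[G] satisfies e_ρ = e_η + e_{η^x} + … + e_{η^{x^{p-1}}}. -/

import Mathlib

open scoped TensorProduct

section Defs

variable {k : Type*} [Field k] {M : Type*} [Monoid M]

/-- Equivalence (isomorphism) of representations of a monoid over a field. -/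
def RepIso {V W : Type*} [AddCommGroup V] [Module k V] [AddCommGroup W] [Module k W]
    (ρ : Representation k M V) (ρ' : Representation k M W) : Prop :=
  ∃ e : V ≃ₗ[k] W, ∀ (g : M) (v : V), e (ρ g v) = ρ' g (e v)

/-- Irreducibility of a representation: the space is nonzero and has no proper nonzero
invariant subspace. -/
def RepIrred {V : Type*} [AddCommGroup V] [Module k V] (ρ : Representation k M V) : Prop :=
  Nontrivial V ∧ ∀ U : Submodule k V, (∀ g : M, ∀ v ∈ U, ρ g v ∈ U) → U = ⊥ ∨ U = ⊤

variable {G : Type*} [Group G]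

/-- Conjugation by `x` as a monoid homomorphism of a normal subgroup. -/
def conjHom {H : Subgroup G} (hH : H.Normal) (x : G) : H →* H :=
  MonoidHom.mk' (fun h => ⟨x * (h : G) * x⁻¹, hH.conj_mem (h : G) h.2 x⟩)
    (by intro a b; ext; push_cast; group)

/-- The conjugate representation `η^x`, `η^x(h) = η (x h x⁻¹)`. -/
def ConjRep {H : Subgroup G} (hH : H.Normal) (x : G) {V : Type*} [AddCommGroup V] [Module k V]
    (η : Representation k H V) : Representation k H V :=
  η.comp (conjHom hH x)

/-- `ρ` is (a model of) the representation of `G` induced from the representation `η` of the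
subgroup `H`: there is an `H`-equivariant embedding `ι : V → W` and `W` is the internal direct
sum, over the cosets `gH`, of the translates `ρ(g)(ι V)`. -/
def IsInducedFrom (H : Subgroup G) {V W : Type*} [AddCommGroup V] [Module k V]
    [AddCommGroup W] [Module k W]
    (η : Representation k H V) (ρ : Representation k G W) : Prop :=
  ∃ ι : V →ₗ[k] W, Function.Injective ι ∧
    (∀ (h : H) (v : V), ι (η h v) = ρ (h : G) (ι v)) ∧
    ∃ S : G ⧸ H → Submodule k W,
      (∀ g : G, S (g : G ⧸ H) = (LinearMap.range ι).map (ρ g)) ∧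
      iSupIndep S ∧ iSup S = ⊤

/-- The subrepresentation on an invariant subspace. -/
def SubRep {V : Type*} [AddCommGroup V] [Module k V] (ρ : Representation k M V)
    (U : Submodule k V) (hU : ∀ g : M, ∀ v ∈ U, ρ g v ∈ U) : Representation k M U where
  toFun g := LinearMap.restrict (ρ g) (hU g)
  map_one' := by ext v; simp [LinearMap.restrict_apply]
  map_mul' g g' := by ext v; simp [LinearMap.restrict_apply]

/-- The direct sum of a family of representations (realized on the product space). -/
def PiRep {ι : Type*} {W : ι → Type*} [∀ i, AddCommGroup (W i)] [∀ i, Module k (W i)]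
    (ρ : ∀ i, Representation k M (W i)) : Representation k M (∀ i, W i) where
  toFun g := LinearMap.pi fun i => (ρ i g).comp (LinearMap.proj i)
  map_one' := by ext v; simp
  map_mul' g g' := by ext v; simp

/-- Extension of scalars of a representation along a field extension `F ⊆ E`. -/
noncomputable def BaseChangeRep {F : Type*} [Field F] (E : Type*) [Field E] [Algebra F E]
    {V : Type*} [AddCommGroup V] [Module F V] (ρ : Representation F M V) :
    Representation E M (E ⊗[F] V) where
  toFun g := LinearMap.baseChange E (ρ g)
  map_one' := by ext v; simp
  map_mul' g g' := by ext v; simp [map_mul]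

open scoped Classical in
/-- The conjugacy class sum of `x` in the group algebra. -/
noncomputable def classSum (k : Type*) [Field k] {G : Type*} [Group G] [Fintype G] (x : G) :
    MonoidAlgebra k G :=
  ∑ g : G, if IsConj x g then MonoidAlgebra.single g (1 : k) else 0

/-- A primitive central idempotent of a ring. -/
def IsPrimCentralIdem {R : Type*} [Ring R] (e : R) : Prop :=
  e ≠ 0 ∧ IsIdempotentElem e ∧ e ∈ Set.center R ∧
    ∀ f : R, f ∈ Set.center R → IsIdempotentElem f → f * e = f → f = 0 ∨ f = e

/-- `e` is the primitive central idempotent of the group algebra attached to the irreducible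
representation `ρ`: it is a primitive central idempotent acting as the identity on `ρ`. -/
noncomputable def IsIdemFor {V : Type*} [AddCommGroup V] [Module k V]
    (ρ : Representation k M V) (e : MonoidAlgebra k M) : Prop :=
  IsPrimCentralIdem e ∧ ρ.asAlgebraHom e = 1

/-- `ρ'` is the twist of the `E`-representation `ρ` by the automorphism `γ` of `E` over `F`. -/
def IsTwist {F E : Type*} [Field F] [Field E] [Algebra F E]
    {V W : Type*} [AddCommGroup V] [Module E V] [AddCommGroup W] [Module E W]
    (γ : E ≃ₐ[F] E) (ρ : Representation E M V) (ρ' : Representation E M W) : Prop :=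
  ∃ e : V ≃+ W, (∀ (c : E) (v : V), e (c • v) = γ c • e v) ∧
    ∀ (g : M) (v : V), e (ρ g v) = ρ' g (e v)

/-- Two `E`-representations are Galois conjugate over `F`. -/
def IsGaloisConj (F : Type*) {E : Type*} [Field F] [Field E] [Algebra F E]
    {V W : Type*} [AddCommGroup V] [Module E V] [AddCommGroup W] [Module E W]
    (ρ : Representation E M V) (ρ' : Representation E M W) : Prop :=
  ∃ γ : E ≃ₐ[F] E, IsTwist γ ρ ρ'

/-- The canonical embedding of the group algebra of a subgroup into the group algebra
of the ambient group. -/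
noncomputable def algEmb (k : Type*) [Field k] {G : Type*} [Group G] (H : Subgroup G) :
    MonoidAlgebra k H →ₐ[k] MonoidAlgebra k G :=
  MonoidAlgebra.mapDomainAlgHom k k H.subtype

end Defs

section Aux

theorem pci_orth {R : Type*} [Ring R] {e f : R} (he : IsPrimCentralIdem e)
    (hf : IsPrimCentralIdem f) : e * f = 0 ∨ e = f := by
  obtain ⟨_, he1, he2, he3⟩ := he
  obtain ⟨_, hf1, hf2, hf3⟩ := hf
  have hc : e * f = f * e := (Semigroup.mem_center_iff.1 hf2 e)
  have hcen : e * f ∈ Set.center R := Set.mul_mem_center he2 hf2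
  have hid : IsIdempotentElem (e * f) := IsIdempotentElem.mul_of_commute hc he1 hf1
  have h1 := he3 (e * f) hcen hid (by rw [hc, mul_assoc, he1.eq])
  have h2 := hf3 (e * f) hcen hid (by rw [mul_assoc, hf1.eq])
  rcases h1 with h1 | h1
  · exact Or.inl h1
  · rcases h2 with h2 | h2
    · exact Or.inl h2
    · exact Or.inr (h1.symm.trans h2)

theorem pci_map {R : Type*} [Ring R] (φ ψ : R →+* R) (h1 : ∀ a, φ (ψ a) = a)
    (h2 : ∀ a, ψ (φ a) = a) {e : R} (he : IsPrimCentralIdem e) : IsPrimCentralIdem (φ e) := by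
  have cen : ∀ (φ ψ : R →+* R), (∀ a, φ (ψ a) = a) → ∀ a ∈ Set.center R,
      φ a ∈ Set.center R := by
    intro φ ψ h1 a ha
    rw [Semigroup.mem_center_iff] at ha ⊢
    intro g
    rw [← h1 g, ← map_mul, ← map_mul, ha]
  obtain ⟨he0, he1, he2, he3⟩ := he
  refine ⟨fun h => he0 ?_, ?_, cen φ ψ h1 e he2, fun f hf hf1 hf2 => ?_⟩
  · rw [← h2 e, h, map_zero]
  · exact he1.map φ
  · have := he3 (ψ f) (cen ψ φ h2 f hf) (hf1.map ψ) (by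
      rw [← h2 e, ← map_mul, hf2])
    rcases this with h | h
    · left; rw [← h1 f, h, map_zero]
    · right; rw [← h, h1]

variable {F : Type*} [Field F] {G : Type*} [Group G]

noncomputable def cg {H : Subgroup G} (hH : H.Normal) (g : G) :
    MonoidAlgebra F H →ₐ[F] MonoidAlgebra F H :=
  MonoidAlgebra.mapDomainAlgHom F F (conjHom hH g)

theorem algEmb_of {H : Subgroup G} (h : H) :
    algEmb F H (MonoidAlgebra.of F H h) = MonoidAlgebra.of F G (h : G) := by
  simp [algEmb]

theorem algEmb_inj {H : Subgroup G} : Function.Injective (algEmb F H) := by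
  intro a b hab
  exact MonoidAlgebra.mapDomain_injective H.subtype_injective hab

theorem cg_of {H : Subgroup G} (hH : H.Normal) (g : G) (h : H) :
    cg hH g (MonoidAlgebra.of F H h) = MonoidAlgebra.of F H (conjHom hH g h) := by
  simp [cg]

theorem algEmb_cg {H : Subgroup G} (hH : H.Normal) (g : G) (b : MonoidAlgebra F H) :
    algEmb F H (cg hH g b) =
      MonoidAlgebra.of F G g * algEmb F H b * MonoidAlgebra.of F G g⁻¹ := by
  induction b using MonoidAlgebra.induction_on with
  | of h =>
    rw [cg_of, algEmb_of, algEmb_of, ← map_mul, ← map_mul]; rfl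
  | add a b ha hb => rw [map_add, map_add, ha, hb, map_add, mul_add, add_mul]
  | smul r a ha => rw [map_smul, map_smul, ha, map_smul]; simp

theorem cg_cg {H : Subgroup G} (hH : H.Normal) (g g' : G) (b : MonoidAlgebra F H) :
    cg hH g (cg hH g' b) = cg hH (g * g') b := by
  apply algEmb_inj
  rw [algEmb_cg, algEmb_cg, algEmb_cg, mul_inv_rev, map_mul, map_mul]
  simp only [mul_assoc]

theorem cg_one {H : Subgroup G} (hH : H.Normal) (b : MonoidAlgebra F H) :
    cg hH 1 b = b := by
  apply algEmb_inj
  rw [algEmb_cg, inv_one, map_one, one_mul, mul_one]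

theorem pci_cg {H : Subgroup G} (hH : H.Normal) (g : G) {b : MonoidAlgebra F H}
    (hb : IsPrimCentralIdem b) : IsPrimCentralIdem (cg hH g b) :=
  pci_map (cg hH g).toRingHom (cg hH g⁻¹).toRingHom
    (fun a => by
      change cg hH g (cg hH g⁻¹ a) = a
      rw [cg_cg, mul_inv_cancel, cg_one])
    (fun a => by
      change cg hH g⁻¹ (cg hH g a) = a
      rw [cg_cg, inv_mul_cancel, cg_one]) hb

theorem conjRep_alg {H : Subgroup G} (hH : H.Normal) (g : G) {V : Type*} [AddCommGroup V]
    [Module F V] (η : Representation F H V) (b : MonoidAlgebra F H) :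
    (ConjRep hH g η).asAlgebraHom b = η.asAlgebraHom (cg hH g b) := by
  induction b using MonoidAlgebra.induction_on with
  | of h => rw [cg_of, Representation.asAlgebraHom_of, Representation.asAlgebraHom_of]; rfl
  | add a b ha hb => rw [map_add, ha, hb, map_add, map_add]
  | smul r a ha => rw [map_smul, ha, map_smul, map_smul]

theorem iota_alg {H : Subgroup G} {V W : Type*} [AddCommGroup V] [Module F V]
    [AddCommGroup W] [Module F W] (η : Representation F H V) (ρ : Representation F G W)
    (ι : V →ₗ[F] W) (hι : ∀ (h : H) (v : V), ι (η h v) = ρ (h : G) (ι v))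
    (b : MonoidAlgebra F H) (v : V) :
    ρ.asAlgebraHom (algEmb F H b) (ι v) = ι (η.asAlgebraHom b v) := by
  induction b using MonoidAlgebra.induction_on with
  | of h => rw [algEmb_of, Representation.asAlgebraHom_of, Representation.asAlgebraHom_of, hι]
  | add a b ha hb => simp only [map_add, LinearMap.add_apply, ha, hb]
  | smul r a ha => simp only [map_smul, LinearMap.smul_apply, ha]

theorem idemFor_unique {M : Type*} [Monoid M] {V : Type*} [AddCommGroup V] [Nontrivial V]
    [Module F V] (ρ : Representation F M V) {e f : MonoidAlgebra F M} (he : IsIdemFor ρ e)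
    (hf : IsIdemFor ρ f) : e = f := by
  rcases pci_orth he.1 hf.1 with h | h
  · have := congrArg ρ.asAlgebraHom h
    rw [map_mul, he.2, hf.2, map_zero, mul_one] at this
    exact absurd this one_ne_zero
  · exact h

theorem center_of {a : MonoidAlgebra F G}
    (h : ∀ g, MonoidAlgebra.of F G g * a = a * MonoidAlgebra.of F G g) :
    a ∈ Set.center (MonoidAlgebra F G) := by
  rw [Semigroup.mem_center_iff]
  intro b
  induction b using MonoidAlgebra.induction_on with
  | of g => exact h g
  | add b c hb hc => rw [add_mul, mul_add, hb, hc]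
  | smul r b hb => rw [smul_mul_assoc, mul_smul_comm, hb]

theorem emb_comm {H : Subgroup G} {e : MonoidAlgebra F H}
    (he : e ∈ Set.center (MonoidAlgebra F H)) {h : G} (hh : h ∈ H) :
    MonoidAlgebra.of F G h * algEmb F H e = algEmb F H e * MonoidAlgebra.of F G h := by
  have := Semigroup.mem_center_iff.1 he (MonoidAlgebra.of F H ⟨h, hh⟩)
  have := congrArg (algEmb F H) this
  rwa [map_mul, map_mul, algEmb_of] at this

theorem of_cancel (g : G) : MonoidAlgebra.of F G g * MonoidAlgebra.of F G g⁻¹ = 1 := by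
  rw [← map_mul, mul_inv_cancel, map_one]

theorem of_cancel' (g : G) : MonoidAlgebra.of F G g⁻¹ * MonoidAlgebra.of F G g = 1 := by
  rw [← map_mul, inv_mul_cancel, map_one]

theorem key_orth {p : ℕ} (hp : p.Prime) {H : Subgroup G} (hH : H.Normal)
    (hidx : H.index = p) {e : MonoidAlgebra F H} (he : IsPrimCentralIdem e)
    (hnc : algEmb F H e ∉ Set.center (MonoidAlgebra F G)) {g : G} (hg : g ∉ H) :
    algEmb F H e * MonoidAlgebra.of F G g * algEmb F H e = 0 := by
  have hne : e ≠ cg hH g e := by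
    intro heq
    apply hnc
    let K : Subgroup G :=
      { carrier := {g | MonoidAlgebra.of F G g * algEmb F H e
            = algEmb F H e * MonoidAlgebra.of F G g}
        one_mem' := by simp only [Set.mem_ofPred_eq, map_one, one_mul, mul_one]
        mul_mem' := by
          intro a b ha hb
          simp only [Set.mem_ofPred_eq] at ha hb ⊢
          rw [map_mul, mul_assoc, hb, ← mul_assoc, ha, mul_assoc]
        inv_mem' := by
          intro a ha
          simp only [Set.mem_ofPred_eq] at ha ⊢
          calc MonoidAlgebra.of F G a⁻¹ * algEmb F H e
              = MonoidAlgebra.of F G a⁻¹ * (algEmb F H e * MonoidAlgebra.of F G a) *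
                  MonoidAlgebra.of F G a⁻¹ := by
                rw [mul_assoc, mul_assoc, of_cancel, mul_one]
            _ = _ := by rw [← ha, ← mul_assoc, of_cancel', one_mul] }
    have hHK : H ≤ K := fun h hh => emb_comm he.2.2.1 hh
    have hgK : g ∈ K := by
      change MonoidAlgebra.of F G g * algEmb F H e = algEmb F H e * MonoidAlgebra.of F G g
      have h1 := algEmb_cg hH g e
      rw [← heq] at h1
      nth_rewrite 2 [h1]
      rw [mul_assoc _ _ (MonoidAlgebra.of F G g), of_cancel', mul_one]
    have hdvd : K.index ∣ p := hidx ▸ Subgroup.index_dvd_of_le hHK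
    have hmul := Subgroup.relIndex_mul_index hHK
    have hK : K = ⊤ := by
      rcases (Nat.dvd_prime hp).1 hdvd with h | h
      · exact Subgroup.index_eq_one.1 h
      · exfalso
        rw [h, hidx] at hmul
        have : H.relIndex K = 1 := Nat.eq_of_mul_eq_mul_right hp.pos (by rw [hmul, one_mul])
        exact hg (Subgroup.relIndex_eq_one.1 this hgK)
    apply center_of
    intro g'
    have : g' ∈ K := hK ▸ Subgroup.mem_top g'
    exact this
  rcases pci_orth he (pci_cg hH g he) with h | h
  · have h2 := congrArg (algEmb F H) h
    rw [map_mul, algEmb_cg, map_zero] at h2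
    have h3 := congrArg (· * MonoidAlgebra.of F G g) h2
    simp only [zero_mul] at h3
    rw [← h3]
    simp only [mul_assoc, of_cancel', mul_one]
  · exact absurd h hne

/-- the coset-indexed conjugates -/
noncomputable def eq' {H : Subgroup G} (e : MonoidAlgebra F H) (q : G ⧸ H) : MonoidAlgebra F G :=
  MonoidAlgebra.of F G q.out * algEmb F H e * MonoidAlgebra.of F G q.out⁻¹

theorem eq'_mk {H : Subgroup G} {e : MonoidAlgebra F H}
    (he : e ∈ Set.center (MonoidAlgebra F H)) (g : G) :
    eq' e (g : G ⧸ H) = MonoidAlgebra.of F G g * algEmb F H e * MonoidAlgebra.of F G g⁻¹ := by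
  obtain ⟨h, hh⟩ := QuotientGroup.mk_out_eq_mul H g
  rw [eq', hh, mul_inv_rev, map_mul, map_mul, mul_assoc (MonoidAlgebra.of F G g),
    emb_comm he h.2]
  simp only [mul_assoc]
  rw [← mul_assoc (MonoidAlgebra.of F G (h : G)), of_cancel, one_mul]

section Ind
variable {H : Subgroup G} {V W : Type*} [AddCommGroup V] [Module F V]
    [AddCommGroup W] [Module F W]

noncomputable def phi [Fintype (G ⧸ H)] (ρ : Representation F G W) (ι : V →ₗ[F] W) :
    (G ⧸ H → V) →ₗ[F] W :=
  ∑ q : G ⧸ H, (ρ q.out ∘ₗ ι) ∘ₗ LinearMap.proj q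

theorem phi_apply [Fintype (G ⧸ H)] (ρ : Representation F G W) (ι : V →ₗ[F] W)
    (v : G ⧸ H → V) : phi ρ ι v = ∑ q : G ⧸ H, ρ q.out (ι (v q)) := by
  simp [phi]

theorem rho_inj (ρ : Representation F G W) (g : G) : Function.Injective (ρ g) := by
  intro a b h
  have := congrArg (ρ g⁻¹) h
  simpa using this

theorem phi_bij [Fintype (G ⧸ H)] (ρ : Representation F G W) (ι : V →ₗ[F] W)
    (hinj : Function.Injective ι) (S : G ⧸ H → Submodule F W)
    (hS : ∀ g : G, S (g : G ⧸ H) = (LinearMap.range ι).map (ρ g))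
    (hind : iSupIndep S) (htop : iSup S = ⊤) : Function.Bijective (phi (H := H) ρ ι) := by
  have hmem : ∀ (q : G ⧸ H) (v : V), ρ q.out (ι v) ∈ S q := by
    intro q v
    have := hS q.out
    rw [QuotientGroup.out_eq'] at this
    rw [this]
    exact ⟨ι v, ⟨v, rfl⟩, rfl⟩
  constructor
  · rw [← LinearMap.ker_eq_bot, LinearMap.ker_eq_bot']
    intro v hv
    rw [phi_apply] at hv
    have h0 := (iSupIndep_iff_finsetSum_eq_zero_imp_eq_zero S).1 hind Finset.univ
      (fun q => ρ q.out (ι (v q))) (fun q _ => hmem q _) hv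
    funext q
    have := h0 q (Finset.mem_univ q)
    apply hinj
    apply rho_inj ρ q.out
    simpa using this
  · rw [← LinearMap.range_eq_top, ← top_le_iff, ← htop]
    apply iSup_le
    intro q w hw
    classical
    have := hS q.out
    rw [QuotientGroup.out_eq'] at this
    rw [this] at hw
    obtain ⟨_, ⟨v, rfl⟩, rfl⟩ := hw
    refine ⟨Pi.single q v, ?_⟩
    rw [phi_apply, Finset.sum_eq_single q]
    · simp
    · intro b _ hb; simp [Pi.single_eq_of_ne hb]
    · simp

theorem hmemT (g : G) (q : G ⧸ H) : (g • q).out⁻¹ * g * q.out ∈ H := by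
  rw [mul_assoc]
  apply QuotientGroup.eq.1
  rw [QuotientGroup.out_eq', ← smul_eq_mul, ← MulAction.Quotient.smul_mk, QuotientGroup.out_eq']

theorem phi_equiv [Fintype (G ⧸ H)] (η : Representation F H V) (ρ : Representation F G W)
    (ι : V →ₗ[F] W) (hι : ∀ (h : H) (v : V), ι (η h v) = ρ (h : G) (ι v))
    (g : G) (v : G ⧸ H → V) :
    ρ g (phi ρ ι v) = phi ρ ι (fun q =>
      η ⟨(g • (g⁻¹ • q)).out⁻¹ * g * (g⁻¹ • q).out, hmemT g (g⁻¹ • q)⟩ (v (g⁻¹ • q))) := by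
  rw [phi_apply, phi_apply, map_sum]
  refine Fintype.sum_equiv (MulAction.toPerm g) _ _ ?_
  intro q
  simp only [MulAction.toPerm_apply, hι, inv_smul_smul]
  simp only [← Module.End.mul_apply, ← map_mul]
  congr 2
  group

theorem ind_iso {W' : Type*} [AddCommGroup W'] [Module F W'] [Fintype (G ⧸ H)]
    (η : Representation F H V) (ρ : Representation F G W)
    (ρ' : Representation F G W') (h : IsInducedFrom H η ρ) (h' : IsInducedFrom H η ρ') :
    RepIso ρ ρ' := by
  obtain ⟨ι, hinj, hι, S, hS, hind, htop⟩ := h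
  obtain ⟨ι', hinj', hι', S', hS', hind', htop'⟩ := h'
  let a := LinearEquiv.ofBijective (phi (H := H) ρ ι) (phi_bij ρ ι hinj S hS hind htop)
  let b := LinearEquiv.ofBijective (phi (H := H) ρ' ι') (phi_bij ρ' ι' hinj' S' hS' hind' htop')
  refine ⟨a.symm.trans b, fun g w => ?_⟩
  obtain ⟨v, rfl⟩ := a.surjective w
  simp only [LinearEquiv.trans_apply, LinearEquiv.symm_apply_apply]
  have h1 : ρ g (a v) = a _ := phi_equiv η ρ ι hι g v
  have h2 : ρ' g (b v) = b _ := phi_equiv η ρ' ι' hι' g v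
  rw [h1, h2, LinearEquiv.symm_apply_apply]

theorem ind_conj (hH : H.Normal) (g : G) (η : Representation F H V) (ρ : Representation F G W)
    (h : IsInducedFrom H (ConjRep hH g η) ρ) : IsInducedFrom H η ρ := by
  obtain ⟨ι, hinj, hι, S, hS, hind, htop⟩ := h
  refine ⟨ρ g ∘ₗ ι, (rho_inj ρ g).comp hinj, ?_, fun q => S (q * (g : G ⧸ H)), ?_, ?_, ?_⟩
  · intro h v
    have := hι (conjHom hH g⁻¹ h) v
    have h1 : ConjRep hH g η (conjHom hH g⁻¹ h) = η h := by
      change η (conjHom hH g (conjHom hH g⁻¹ h)) = η h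
      congr 1
      ext
      change g * (g⁻¹ * (h : G) * g⁻¹⁻¹) * g⁻¹ = h
      group
    rw [h1] at this
    simp only [LinearMap.comp_apply, this]
    simp only [← Module.End.mul_apply, ← map_mul]
    congr 2
    change g * (g⁻¹ * (h : G) * g⁻¹⁻¹) = h * g
    group
  · intro g'
    have := hS (g' * g)
    rw [QuotientGroup.mk_mul] at this
    simp only []
    rw [this, LinearMap.range_comp, ← Submodule.map_comp, map_mul]
    rfl
  · exact hind.comp (mul_left_injective _)
  · rw [← htop]
    exact (Equiv.mulRight (g : G ⧸ H)).iSup_comp (g := S)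

end Ind

end Aux


/-- If `e_η` is not central in `F[G]`, then the induced representations
`η↑, η^x↑, …, η^{x^{p-1}}↑` are all equivalent to a single irreducible representation `ρ`
of `G`, and `e_ρ = e_η + e_{η^x} + ⋯ + e_{η^{x^{p-1}}}`. -/
theorem stmt_4 {F : Type*} [Field F] [IsAlgClosed F] {G : Type*} [Group G] [Fintype G]
    (hchar : CharZero F ∨ Nat.Coprime (ringChar F) (Fintype.card G))
    (p : ℕ) (hp : p.Prime) (H : Subgroup G) [hH : H.Normal] (hidx : H.index = p)
    (x : G) (hx : Subgroup.zpowers ((x : G ⧸ H)) = ⊤)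
    {V : Type*} [AddCommGroup V] [Module F V]
    (η : Representation F H V) (hirr : RepIrred η)
    (e : MonoidAlgebra F H) (he : IsIdemFor η e)
    (hncent : algEmb F H e ∉ Set.center (MonoidAlgebra F G))
    (d : Fin p → MonoidAlgebra F H)
    (hd : ∀ j : Fin p, IsIdemFor (ConjRep hH (x ^ (j : ℕ)) η) (d j))
    (hd0 : d ⟨0, hp.pos⟩ = e) :
    ∀ {W : Type*} [AddCommGroup W] [Module F W] (ρ : Representation F G W),
      IsInducedFrom H η ρ →
      RepIrred ρ ∧
      (∀ (j : Fin p) {W' : Type*} [AddCommGroup W'] [Module F W']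
          (ρ' : Representation F G W'),
          IsInducedFrom H (ConjRep hH (x ^ (j : ℕ)) η) ρ' → RepIso ρ ρ') ∧
      (∀ Eρ : MonoidAlgebra F G, IsIdemFor ρ Eρ → Eρ = ∑ j : Fin p, algEmb F H (d j)) := by
  intro W _ _ ρ hρ
  have hpci := he.1
  have hcen := hpci.2.2.1
  have hVnt : Nontrivial V := hirr.1
  have hfin : Fintype (G ⧸ H) := Fintype.ofFinite _
  obtain ⟨ι, hinj, hι, S, hS, hind, htop⟩ := id hρ
  have hWnt : Nontrivial W := hinj.nontrivial
  set ε := algEmb F H e with hε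
  have hεid : ε * ε = ε := by rw [hε, ← map_mul, hpci.2.1.eq]
  have horth : ∀ g : G, g ∉ H → ε * MonoidAlgebra.of F G g * ε = 0 :=
    fun g hg => key_orth hp hH hidx hpci hncent hg
  have hcomm : ∀ h : G, h ∈ H → MonoidAlgebra.of F G h * ε = ε * MonoidAlgebra.of F G h :=
    fun h hh => emb_comm hcen hh
  have hει : ∀ v, ρ.asAlgebraHom ε (ι v) = ι v := by
    intro v
    rw [hε, iota_alg η ρ ι hι, he.2]; rfl
  -- span
  have hspan : ∀ U : Submodule F W, (∀ g v, ρ g (ι v) ∈ U) → U = ⊤ := by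
    intro U hU
    rw [← top_le_iff, ← htop]
    apply iSup_le
    intro q
    obtain ⟨g, rfl⟩ := QuotientGroup.mk_surjective q
    rw [hS]
    rintro _ ⟨_, ⟨v, rfl⟩, rfl⟩
    exact hU g v
  -- the sum
  set E : MonoidAlgebra F G := ∑ q : G ⧸ H, eq' e q with hE
  have hmk := fun g => eq'_mk hcen g
  have hEcen : ∀ g, MonoidAlgebra.of F G g * E = E * MonoidAlgebra.of F G g := by
    intro g
    rw [hE, Finset.mul_sum, Finset.sum_mul]
    refine Fintype.sum_equiv (MulAction.toPerm g) _ _ ?_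
    intro q
    obtain ⟨a, rfl⟩ := QuotientGroup.mk_surjective q
    rw [MulAction.toPerm_apply, MulAction.Quotient.smul_coe, hmk, hmk, smul_eq_mul, mul_inv_rev,
      map_mul, map_mul]
    simp only [mul_assoc, of_cancel', mul_one]
  have hEC : E ∈ Set.center (MonoidAlgebra F G) := center_of hEcen
  have hEε : E * ε = ε := by
    rw [hE, Finset.sum_mul, Finset.sum_eq_single ((1 : G) : G ⧸ H)]
    · rw [hmk, inv_one, map_one, one_mul, mul_one, hεid]
    · intro q _ hq
      obtain ⟨a, rfl⟩ := QuotientGroup.mk_surjective q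
      rw [hmk, mul_assoc, mul_assoc, ← mul_assoc (algEmb F H e), horth, mul_zero]
      intro ha
      apply hq
      rw [QuotientGroup.eq]
      simpa using ha
    · simp
  have hEidem : IsIdempotentElem E := by
    change E * E = E
    nth_rewrite 2 [hE]
    rw [Finset.mul_sum]
    nth_rewrite 2 [hE]
    refine Finset.sum_congr rfl fun q _ => ?_
    rw [eq', ← mul_assoc, ← mul_assoc, ← hEcen, mul_assoc _ E, hEε]
  have hEone : ρ.asAlgebraHom E = 1 := by
    have := hspan (LinearMap.eqLocus (ρ.asAlgebraHom E) 1) (by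
      intro g v
      rw [LinearMap.mem_eqLocus, ← hει v, ← Representation.asAlgebraHom_of ρ]
      simp only [← Module.End.mul_apply, ← map_mul, one_mul]
      rw [← mul_assoc, ← hEcen, mul_assoc, hEε])
    exact LinearMap.eqLocus_eq_top.1 this
  -- image of ε
  have hεran : ∀ w, ρ.asAlgebraHom ε w ∈ LinearMap.range ι := by
    have := hspan ((LinearMap.range ι).comap (ρ.asAlgebraHom ε)) (by
      intro g v
      rw [Submodule.mem_comap]
      by_cases hg : g ∈ H
      · have h1 := hι ⟨g, hg⟩ v
        simp only at h1
        rw [← h1, hει]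
        exact ⟨_, rfl⟩
      · rw [← hει v, ← Representation.asAlgebraHom_of ρ]
        simp only [← Module.End.mul_apply, ← map_mul]
        rw [← mul_assoc, horth g hg, map_zero]
        exact Submodule.zero_mem _)
    intro w
    have hw : w ∈ (⊤ : Submodule F W) := trivial
    rw [← this] at hw
    exact hw
  refine ⟨⟨hWnt, ?_⟩, ?_, ?_⟩
  · intro U hU
    have hUalg : ∀ (a : MonoidAlgebra F G), ∀ u ∈ U, ρ.asAlgebraHom a u ∈ U := by
      intro a u hu
      induction a using MonoidAlgebra.induction_on with
      | of g => rw [Representation.asAlgebraHom_of]; exact hU g u hu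
      | add a b ha hb => rw [map_add]; exact U.add_mem ha hb
      | smul r a ha => rw [map_smul]; exact U.smul_mem r ha
    by_cases hbot : U = ⊥
    · exact Or.inl hbot
    right
    obtain ⟨u, hu, hu0⟩ := Submodule.exists_mem_ne_zero_of_ne_bot hbot
    have hex : ∃ g : G, ρ.asAlgebraHom ε (ρ g u) ≠ 0 := by
      by_contra! hcon
      apply hu0
      have h1 : ρ.asAlgebraHom E u = u := by rw [hEone]; rfl
      rw [← h1, hE, map_sum, LinearMap.sum_apply]
      refine Finset.sum_eq_zero fun q _ => ?_
      rw [eq', mul_assoc, map_mul, map_mul, Module.End.mul_apply, Module.End.mul_apply,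
        Representation.asAlgebraHom_of, Representation.asAlgebraHom_of, hcon, map_zero]
    obtain ⟨g, hg⟩ := hex
    obtain ⟨v, hv⟩ := hεran (ρ g u)
    have hvU : ι v ∈ U := by rw [hv]; exact hUalg _ _ (hU g u hu)
    have hcom : U.comap ι = ⊤ := by
      rcases hirr.2 (U.comap ι) (by
        intro h v hv
        rw [Submodule.mem_comap] at hv ⊢
        rw [hι]
        exact hU _ _ hv) with h | h
      · exfalso
        have : v ∈ U.comap ι := hvU
        rw [h, Submodule.mem_bot] at this
        rw [this, map_zero] at hv
        exact hg hv.symm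
      · exact h
    apply hspan
    intro g v
    apply hU
    have : v ∈ U.comap ι := by rw [hcom]; trivial
    exact this
  · intro j W' _ _ ρ' hρ'
    exact ind_iso η ρ ρ' hρ (ind_conj hH _ η ρ' hρ')
  · intro Eρ hEρ
    -- the sum in the statement
    have hsum : ∑ j : Fin p, algEmb F H (d j) = E := by
      have hdj : ∀ j : Fin p, algEmb F H (d j) = eq' e (((x ^ (j : ℕ))⁻¹ : G) : G ⧸ H) := by
        intro j
        rw [hmk, ← algEmb_cg hH]
        congr 1
        refine idemFor_unique _ (hd j) ⟨pci_cg hH _ hpci, ?_⟩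
        rw [conjRep_alg, cg_cg, mul_inv_cancel, cg_one, he.2]
      have hcard : Fintype.card (G ⧸ H) = p := by
        rw [← hidx, Subgroup.index, Nat.card_eq_fintype_card]
      have hord : orderOf (x : G ⧸ H) = p := by
        rw [← Nat.card_zpowers, hx, ← hcard, ← Nat.card_eq_fintype_card]
        exact Subgroup.card_top
      have hbij : Function.Bijective
          (fun j : Fin p => (((x ^ (j : ℕ))⁻¹ : G) : G ⧸ H)) := by
        rw [Fintype.bijective_iff_injective_and_card]
        refine ⟨fun i j hij => ?_, by rw [hcard, Fintype.card_fin]⟩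
        simp only [QuotientGroup.mk_inv, QuotientGroup.mk_pow, inv_inj] at hij
        have := pow_injOn_Iio_orderOf (x := (x : G ⧸ H))
          (by rw [hord]; exact i.2) (by rw [hord]; exact j.2) hij
        exact Fin.ext this
      rw [hE]
      exact Fintype.sum_bijective _ hbij _ _ hdj
    rw [hsum]
    obtain ⟨⟨_, hi, hc, hprim⟩, hone⟩ := hEρ
    have hc' := Semigroup.mem_center_iff.1 hc
    -- first
    have h1 : Eρ * E = Eρ := by
      rcases hprim (E * Eρ) (Set.mul_mem_center hEC hc)
        (IsIdempotentElem.mul_of_commute (hc' E) hEidem hi) (by rw [mul_assoc, hi.eq]) with h | h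
      · exfalso
        have := congrArg ρ.asAlgebraHom h
        rw [map_mul, hEone, hone, map_zero, mul_one] at this
        exact one_ne_zero this
      · rw [← hc' E, h]
    have heAe : ∀ a : MonoidAlgebra F G, ∃ b : MonoidAlgebra F H, algEmb F H b = ε * a * ε := by
      intro a
      induction a using MonoidAlgebra.induction_on with
      | of g =>
        by_cases hg : g ∈ H
        · exact ⟨e * MonoidAlgebra.of F H ⟨g, hg⟩ * e, by rw [map_mul, map_mul, algEmb_of]⟩
        · exact ⟨0, by rw [horth g hg, map_zero]⟩
      | add a b ha hb =>
        obtain ⟨a', ha⟩ := ha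
        obtain ⟨b', hb⟩ := hb
        exact ⟨a' + b', by rw [map_add, ha, hb, mul_add, add_mul]⟩
      | smul r a ha =>
        obtain ⟨a', ha⟩ := ha
        exact ⟨r • a', by rw [map_smul, ha]; simp⟩
    have h2 : Eρ * ε = ε := by
      obtain ⟨b, hb⟩ := heAe Eρ
      rw [hc', mul_assoc, hεid] at hb
      have hbe : b = 0 ∨ b = e := by
        apply hpci.2.2.2
        · apply center_of
          intro h
          apply algEmb_inj
          rw [map_mul, map_mul, hb, algEmb_of, ← mul_assoc, hc', mul_assoc, mul_assoc,
            hcomm _ h.2]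
        · apply algEmb_inj
          rw [map_mul, hb, mul_assoc, ← mul_assoc ε, hc' ε, mul_assoc Eρ ε, hεid, ← mul_assoc,
            hi.eq]
        · apply algEmb_inj
          rw [map_mul, hb, mul_assoc, hεid]
      rcases hbe with h | h
      · exfalso
        rw [h, map_zero] at hb
        obtain ⟨v, hv⟩ := exists_ne (0 : V)
        apply hv
        apply hinj
        rw [← hει v]
        have h3 := congrArg ρ.asAlgebraHom hb
        rw [map_mul, hone, one_mul, map_zero] at h3
        rw [← h3, map_zero]; rfl
      · rw [← hb, h]
    have h3 : Eρ * E = E := by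
      rw [hE, Finset.mul_sum]
      refine Finset.sum_congr rfl fun q _ => ?_
      rw [eq', ← mul_assoc, ← mul_assoc, ← hc', mul_assoc _ Eρ, h2]
    rw [← h1, h3]
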